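/- Let T, T′ and T″ be triangulations of the completed ∞-gon. If there exists a T-admissible sequence α with μ_α(T) = T′ and a T′-admissible sequence β with μ_β(T′) = T″, then there exists a T-admissible sequence γ with μ_γ(T) = T″. -/

import Mathlib

open scoped Classical

/-- Vertices of the completed ∞-gon: `ℤ ∪ {−∞, +∞}` with the extended linear order. -/
abbrev Vtx : Type := WithBot (WithTop ℤ)

/-- The vertex corresponding to an integer. -/
def vInt (m : ℤ) : Vtx := ((m : WithTop ℤ) : Vtx)

/-- The vertex `+∞`. -/
def vTop : Vtx := ((⊤ : WithTop ℤ) : Vtx)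

/-- The vertex `−∞`. -/
def vBot : Vtx := (⊥ : Vtx)

/-- An arc of the completed ∞-gon: a pair of vertices `src < tgt` such that if both
endpoints are integers then they differ by at least `2`. -/
structure Arc where
  src : Vtx
  tgt : Vtx
  lt : src < tgt
  sep : ∀ m n : ℤ, src = vInt m → tgt = vInt n → m + 2 ≤ n

/-- Two arcs `(a,b)` and `(c,d)` cross if `a < c < b < d` or `c < a < d < b`. -/
def Cross (x y : Arc) : Prop :=
  (x.src < y.src ∧ y.src < x.tgt ∧ x.tgt < y.tgt) ∨
  (y.src < x.src ∧ x.src < y.tgt ∧ y.tgt < x.tgt)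

/-- A triangulation of the completed ∞-gon: a maximal set of pairwise compatible
(= non-crossing) arcs. -/
def IsTriangulation (T : Set Arc) : Prop :=
  (∀ x ∈ T, ∀ y ∈ T, ¬ Cross x y) ∧
  ∀ γ : Arc, (∀ x ∈ T, ¬ Cross γ x) → γ ∈ T

lemma vInt_lt_vTop (m : ℤ) : vInt m < vTop := by
  simpa [vInt, vTop] using WithBot.coe_lt_coe.mpr (WithTop.coe_lt_top (m : ℤ))

lemma vBot_lt_vInt (m : ℤ) : vBot < vInt m := WithBot.bot_lt_coe _

lemma vBot_lt_vTop : vBot < vTop := WithBot.bot_lt_coe _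

lemma vTop_ne_vInt (n : ℤ) : vTop ≠ vInt n := by simp [vTop, vInt]

lemma vBot_ne_vInt (n : ℤ) : vBot ≠ vInt n := by simp [vBot, vInt]

/-- The Prüfer curve `π_m = (m, +∞)`. -/
def prufer (m : ℤ) : Arc :=
  ⟨vInt m, vTop, vInt_lt_vTop m, fun _ n _ h => absurd h (vTop_ne_vInt n)⟩

/-- The adic curve `α_m = (−∞, m)`. -/
def adic (m : ℤ) : Arc :=
  ⟨vBot, vInt m, vBot_lt_vInt m, fun k _ h _ => absurd h (vBot_ne_vInt k)⟩

/-- The generic curve `z = (−∞, +∞)`. -/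
def generic : Arc :=
  ⟨vBot, vTop, vBot_lt_vTop, fun k _ h _ => absurd h (vBot_ne_vInt k)⟩

/-- `T` contains an arc with endpoints `x` and `y`. -/
def HasArc (T : Set Arc) (x y : Vtx) : Prop := ∃ γ ∈ T, γ.src = x ∧ γ.tgt = y

/-- `T` has a right fountain at the integer `n`. -/
def RightFountainInt (T : Set Arc) (n : ℤ) : Prop :=
  {p : ℤ | HasArc T (vInt n) (vInt p)}.Infinite

/-- `T` has a left fountain at the integer `n`. -/
def LeftFountainInt (T : Set Arc) (n : ℤ) : Prop :=
  {p : ℤ | HasArc T (vInt p) (vInt n)}.Infinite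

/-- `T` has a right fountain at the vertex `v`. -/
def RightFountain (T : Set Arc) (v : Vtx) : Prop :=
  (∃ n : ℤ, v = vInt n ∧ RightFountainInt T n) ∨
  (v = vTop ∧ {p : ℤ | 0 ≤ p ∧ prufer p ∈ T}.Infinite) ∨
  (v = vBot ∧ {p : ℤ | 0 ≤ p ∧ adic p ∈ T}.Infinite)

/-- `T` has a left fountain at the vertex `v`. -/
def LeftFountain (T : Set Arc) (v : Vtx) : Prop :=
  (∃ n : ℤ, v = vInt n ∧ LeftFountainInt T n) ∨
  (v = vTop ∧ {p : ℤ | p ≤ 0 ∧ prufer p ∈ T}.Infinite) ∨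
  (v = vBot ∧ {p : ℤ | p ≤ 0 ∧ adic p ∈ T}.Infinite)

/-- `T` is locally finite if every vertex is an endpoint of only finitely many arcs of `T`. -/
def LocallyFin (T : Set Arc) : Prop :=
  ∀ v : Vtx, {γ | γ ∈ T ∧ (γ.src = v ∨ γ.tgt = v)}.Finite

/-- An arc is peripheral if both endpoints are integers. -/
def IsPeripheral (γ : Arc) : Prop :=
  (∃ m : ℤ, γ.src = vInt m) ∧ ∃ n : ℤ, γ.tgt = vInt n

/-- `γ'` is an exchange partner for `γ` relative to `T`:
it is distinct from `γ` and `(T \ {γ}) ∪ {γ'}` is again a triangulation. -/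
def MutExchange (T : Set Arc) (γ γ' : Arc) : Prop :=
  γ' ≠ γ ∧ IsTriangulation ((T \ {γ}) ∪ {γ'})

/-- `γ` is a mutable arc of `T`. -/
def IsMutable (T : Set Arc) (γ : Arc) : Prop :=
  γ ∈ T ∧ ∃ γ', MutExchange T γ γ'

/-- The (unique) replacement arc of `γ` in `T`, when `γ` is mutable. -/
noncomputable def flipArc (T : Set Arc) (γ : Arc) : Arc :=
  if h : ∃ γ', MutExchange T γ γ' then h.choose else γ

/-- The mutation `μ_γ(T)` of `T` at `γ`. -/
noncomputable def mutate (T : Set Arc) (γ : Arc) : Set Arc :=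
  (T \ {γ}) ∪ {flipArc T γ}

/-- `μ_γ(δ)`: the effect of the mutation of `T` at `γ` on the arc `δ`. -/
noncomputable def mutArc (T : Set Arc) (γ δ : Arc) : Arc :=
  if δ = γ then flipArc T γ else δ

/-- One step of a mutation sequence on a set of arcs (`none` = no entry). -/
noncomputable def stepT (T : Set Arc) : Option Arc → Set Arc
  | none => T
  | some γ => mutate T γ

/-- One step of a mutation sequence on a single arc. -/
noncomputable def stepA (T : Set Arc) : Option Arc → Arc → Arc
  | none, δ => δ
  | some γ, δ => mutArc T γ δ

/-- `iterT T θ k` is `μ_{θ_k} ∘ ⋯ ∘ μ_{θ_1}(T)`. Sequences (finite or infinite) are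
encoded as `θ : ℕ → Option Arc` whose support is downward closed. -/
noncomputable def iterT (T : Set Arc) (θ : ℕ → Option Arc) : ℕ → Set Arc
  | 0 => T
  | k + 1 => stepT (iterT T θ k) (θ k)

/-- `iterA T θ γ k` is `μ_{θ_k} ∘ ⋯ ∘ μ_{θ_1}(γ)`. -/
noncomputable def iterA (T : Set Arc) (θ : ℕ → Option Arc) (γ : Arc) : ℕ → Arc
  | 0 => γ
  | k + 1 => stepA (iterT T θ k) (θ k) (iterA T θ γ k)

/-- `θ` is a `T`-admissible sequence: its support is downward closed (so it is a genuine
finite or infinite sequence), each entry is mutable in the triangulation obtained by the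
previous mutations, and the mutation of each arc of `T` along `θ` eventually stabilizes. -/
def Admissible (T : Set Arc) (θ : ℕ → Option Arc) : Prop :=
  (∀ i, θ i = none → θ (i + 1) = none) ∧
  (∀ i γ, θ i = some γ → IsMutable (iterT T θ i) γ) ∧
  (∀ γ ∈ T, ∃ l, ∀ k, l ≤ k → iterA T θ γ k = iterA T θ γ l)

/-- `μ_θ(γ)`: the stable value of the mutation of the arc `γ` along the sequence `θ`. -/
noncomputable def seqLimit (T : Set Arc) (θ : ℕ → Option Arc) (γ : Arc) : Arc :=
  if h : ∃ l, ∀ k, l ≤ k → iterA T θ γ k = iterA T θ γ l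
  then iterA T θ γ h.choose else γ

/-- `μ_θ(T)`: the mutation of `T` along the sequence `θ`. -/
noncomputable def mutSeq (T : Set Arc) (θ : ℕ → Option Arc) : Set Arc :=
  seqLimit T θ '' T

/-- The sequence `θ` leaves the arc `γ` untouched. -/
def Untouched (T : Set Arc) (θ : ℕ → Option Arc) (γ : Arc) : Prop :=
  ∀ l, iterA T θ γ l = γ

/-- The quadrilateral `S(γ)` of a mutable arc `γ` in `T`: with `v₁ < v₂ < v₃ < v₄` the four
endpoints of the two diagonals `γ` and `flipArc T γ`, it consists of those of the pairs
`(v₁,v₂), (v₂,v₃), (v₃,v₄), (v₁,v₄)` that are arcs. -/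
noncomputable def quad (T : Set Arc) (γ : Arc) : Set Arc :=
  let γ' := flipArc T γ
  let vs : Vtx × Vtx × Vtx × Vtx :=
    if γ.src < γ'.src then (γ.src, γ'.src, γ.tgt, γ'.tgt) else (γ'.src, γ.src, γ'.tgt, γ.tgt)
  {δ : Arc | (δ.src = vs.1 ∧ δ.tgt = vs.2.1) ∨ (δ.src = vs.2.1 ∧ δ.tgt = vs.2.2.1) ∨
    (δ.src = vs.2.2.1 ∧ δ.tgt = vs.2.2.2) ∨ (δ.src = vs.1 ∧ δ.tgt = vs.2.2.2)}

/-- The set `𝒫` of Prüfer curves compatible with every arc of `S`. -/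
def pruferCompletion (S : Set Arc) : Set Arc :=
  {γ | (∃ k : ℤ, γ = prufer k) ∧ ∀ x ∈ S, ¬ Cross γ x}

/-- The set `𝒜̃` of adic curves compatible with every arc of `S ∪ 𝒫(S)`. -/
def adicCompletion' (S : Set Arc) : Set Arc :=
  {γ | (∃ k : ℤ, γ = adic k) ∧ ∀ x ∈ S ∪ pruferCompletion S, ¬ Cross γ x}

/-- The completed (Prüfer) mutation `μ̄_θ(T) = μ_θ(T) ∪ 𝒫 ∪ 𝒜̃` of `T` along `θ`. -/
noncomputable def completedMut (T : Set Arc) (θ : ℕ → Option Arc) : Set Arc :=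
  mutSeq T θ ∪ pruferCompletion (mutSeq T θ) ∪ adicCompletion' (mutSeq T θ)

/-- The tower of triangulations associated to a composition of completed mutations. -/
noncomputable def compIter (T : Set Arc) (Θ : ℕ → Option (ℕ → Option Arc)) : ℕ → Set Arc
  | 0 => T
  | k + 1 =>
    match Θ k with
    | none => compIter T Θ k
    | some θ => completedMut (compIter T Θ k) θ

/-- `Θ` is a `T`-admissible composition of completed mutations. -/
def CompAdmissible (T : Set Arc) (Θ : ℕ → Option (ℕ → Option Arc)) : Prop :=
  (∀ i, Θ i = none → Θ (i + 1) = none) ∧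
  ∀ i θ, Θ i = some θ → Admissible (compIter T Θ i) θ

/-- The transfinite mutation of `T` along the composition `Θ`. -/
noncomputable def transfiniteMut (T : Set Arc) (Θ : ℕ → Option (ℕ → Option Arc)) : Set Arc :=
  ⋃ i, {γ ∈ compIter T Θ i |
    ∀ k, i ≤ k → ∀ θ, Θ k = some θ → Untouched (compIter T Θ k) θ γ}


/-! ### Geometry of quadrilaterals -/

lemma Arc.ext' {x y : Arc} (h1 : x.src = y.src) (h2 : x.tgt = y.tgt) : x = y := by
  cases x; cases y; simp_all

lemma Cross.symm {x y : Arc} (h : Cross x y) : Cross y x := by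
  unfold Cross at *; tauto

lemma not_cross_self (x : Arc) : ¬ Cross x x := by
  unfold Cross; intro h; rcases h with h | h <;> exact lt_irrefl _ h.1

lemma exists_arc {u v w : Vtx} (h1 : u < v) (h2 : v < w) : ∃ s : Arc, s.src = u ∧ s.tgt = w := by
  refine ⟨⟨u, w, h1.trans h2, ?_⟩, rfl, rfl⟩
  rintro m n rfl rfl
  induction v using WithBot.recBotCoe with
  | bot => exact absurd h1 not_lt_bot
  | coe v =>
    induction v using WithTop.recTopCoe with
    | top =>
      have := WithBot.coe_lt_coe.mp h2
      exact absurd this not_top_lt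
    | coe p =>
      have a := WithTop.coe_lt_coe.mp (WithBot.coe_lt_coe.mp h1)
      have b := WithTop.coe_lt_coe.mp (WithBot.coe_lt_coe.mp h2)
      omega

/-- `v` is an endpoint of `g`. -/
def IsEnd (g : Arc) (v : Vtx) : Prop := v = g.src ∨ v = g.tgt

/-- The sides of the quadrilateral with diagonals `g` and `g'`. -/
def Sides (g g' : Arc) : Set Arc :=
  {s | (IsEnd g s.src ∨ IsEnd g' s.src) ∧ (IsEnd g s.tgt ∨ IsEnd g' s.tgt) ∧ s ≠ g ∧ s ≠ g'}

lemma sides_symm (g g' : Arc) : Sides g g' = Sides g' g := by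
  ext s; simp only [Sides, Set.mem_ofPred_eq]; tauto

lemma sides_finite (g g' : Arc) : (Sides g g').Finite := by
  have hE : ({g.src, g.tgt, g'.src, g'.tgt} : Set Vtx).Finite := by simp
  refine Set.Finite.of_finite_image (f := fun s : Arc => (s.src, s.tgt))
    ((hE.prod hE).subset ?_) ?_
  · rintro _ ⟨s, ⟨h1, h2, -⟩, rfl⟩
    simp only [IsEnd] at h1 h2
    simp only [Set.mem_prod, Set.mem_insert_iff, Set.mem_singleton_iff]
    tauto
  · intro x _ y _ h
    simp only [Prod.mk.injEq] at h
    exact Arc.ext' h.1 h.2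

lemma sides_not_cross_left {g g' s : Arc} (h : Cross g g') (hs : s ∈ Sides g g') :
    ¬ Cross s g := by
  obtain ⟨h1, h2, h3, h4⟩ := hs
  have h3' : ¬ (s.src = g.src ∧ s.tgt = g.tgt) := fun e => h3 (Arc.ext' e.1 e.2)
  have h4' : ¬ (s.src = g'.src ∧ s.tgt = g'.tgt) := fun e => h4 (Arc.ext' e.1 e.2)
  have := s.lt
  simp only [Cross, IsEnd] at *
  grind

lemma sides_not_cross_right {g g' s : Arc} (h : Cross g g') (hs : s ∈ Sides g g') :
    ¬ Cross s g' :=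
  sides_not_cross_left h.symm (sides_symm g g' ▸ hs)

lemma cross_side {g g' s t : Arc} (h : Cross g g') (hs : s ∈ Sides g g') (ht : Cross t s) :
    Cross t g ∨ Cross t g' := by
  obtain ⟨h1, h2, h3, h4⟩ := hs
  have h3' : ¬ (s.src = g.src ∧ s.tgt = g.tgt) := fun e => h3 (Arc.ext' e.1 e.2)
  have h4' : ¬ (s.src = g'.src ∧ s.tgt = g'.tgt) := fun e => h4 (Arc.ext' e.1 e.2)
  have := s.lt
  have := t.lt
  simp only [Cross, IsEnd] at *
  rcases h with ⟨a, b, c⟩ | ⟨a, b, c⟩ <;> rcases ht with ⟨d, e, f⟩ | ⟨d, e, f⟩ <;>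
    rcases h1 with (h1 | h1) | (h1 | h1) <;> rcases h2 with (h2 | h2) | (h2 | h2) <;>
    first | order | grind

lemma eq_of_cross {g g' t : Arc} (h : Cross g g') (ht : Cross t g)
    (hs : ∀ s ∈ Sides g g', ¬ Cross t s) : t = g' := by
  have key : ∀ u w : Vtx, (IsEnd g u ∨ IsEnd g' u) → (IsEnd g w ∨ IsEnd g' w) →
      ¬ (u = g.src ∧ w = g.tgt) → ¬ (u = g'.src ∧ w = g'.tgt) →
      ¬ (t.src < u ∧ u < t.tgt ∧ t.tgt < w) ∧ ¬ (u < t.src ∧ t.src < w ∧ w < t.tgt) := by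
    intro u w hu hw h3 h4
    constructor
    · rintro ⟨a, b, c⟩
      obtain ⟨s, rfl, rfl⟩ := exists_arc b c
      refine hs s ⟨hu, hw, ?_, ?_⟩ (Or.inl ⟨a, b, c⟩)
      · rintro rfl; exact h3 ⟨rfl, rfl⟩
      · rintro rfl; exact h4 ⟨rfl, rfl⟩
    · rintro ⟨a, b, c⟩
      obtain ⟨s, rfl, rfl⟩ := exists_arc a b
      refine hs s ⟨hu, hw, ?_, ?_⟩ (Or.inr ⟨a, b, c⟩)
      · rintro rfl; exact h3 ⟨rfl, rfl⟩
      · rintro rfl; exact h4 ⟨rfl, rfl⟩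
  have lt := t.lt
  suffices t.src = g'.src ∧ t.tgt = g'.tgt from Arc.ext' this.1 this.2
  unfold Cross at h ht
  rcases h with ⟨a, b, c⟩ | ⟨a, b, c⟩
  · have k1 := key g.src g'.src (by simp [IsEnd]) (by simp [IsEnd])
      (fun e => by order) (fun e => by order)
    have k2 := key g'.src g.tgt (by simp [IsEnd]) (by simp [IsEnd])
      (fun e => by order) (fun e => by order)
    have k3 := key g.tgt g'.tgt (by simp [IsEnd]) (by simp [IsEnd])
      (fun e => by order) (fun e => by order)
    have k4 := key g.src g'.tgt (by simp [IsEnd]) (by simp [IsEnd])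
      (fun e => by order) (fun e => by order)
    clear key hs
    rcases lt_trichotomy t.src g'.src with e | e | e <;>
    rcases lt_trichotomy t.tgt g'.tgt with f | f | f <;>
    rcases lt_trichotomy t.tgt g'.src with f' | f' | f' <;> grind
  · have k1 := key g'.src g.src (by simp [IsEnd]) (by simp [IsEnd])
      (fun e => by order) (fun e => by order)
    have k2 := key g.src g'.tgt (by simp [IsEnd]) (by simp [IsEnd])
      (fun e => by order) (fun e => by order)
    have k3 := key g'.tgt g.tgt (by simp [IsEnd]) (by simp [IsEnd])
      (fun e => by order) (fun e => by order)
    have k4 := key g'.src g.tgt (by simp [IsEnd]) (by simp [IsEnd])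
      (fun e => by order) (fun e => by order)
    clear key hs
    rcases lt_trichotomy t.src g'.src with e | e | e <;>
    rcases lt_trichotomy t.tgt g'.tgt with f | f | f <;>
    rcases lt_trichotomy t.src g'.tgt with f' | f' | f' <;> grind

/-! ### Characterisation of exchanges -/

lemma MutExchange.not_mem {S : Set Arc} (hS : IsTriangulation S) {g g' : Arc} (hg : g ∈ S)
    (h : MutExchange S g g') : g' ∉ S := by
  intro hm
  have h1 : g ∈ (S \ {g}) ∪ {g'} := by
    apply h.2.2
    rintro x (hx | hx)
    · exact hS.1 g hg x hx.1
    · rw [Set.mem_singleton_iff.mp hx]; exact hS.1 g hg g' hm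
  rcases h1 with h1 | h1
  · exact h1.2 rfl
  · exact h.1 (Set.mem_singleton_iff.mp h1).symm

lemma MutExchange.cross {S : Set Arc} (hS : IsTriangulation S) {g g' : Arc} (hg : g ∈ S)
    (h : MutExchange S g g') : Cross g g' := by
  by_contra hc
  apply h.not_mem hS hg
  apply hS.2
  intro x hx hcr
  by_cases e : x = g
  · subst e; exact hc hcr.symm
  · exact h.2.1 g' (Or.inr rfl) x (Or.inl ⟨hx, e⟩) hcr

lemma MutExchange.sides {S : Set Arc} (hS : IsTriangulation S) {g g' : Arc} (hg : g ∈ S)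
    (h : MutExchange S g g') : Sides g g' ⊆ S := by
  intro s hs
  have hc := h.cross hS hg
  apply hS.2
  intro x hx hcr
  rcases cross_side hc hs hcr.symm with h1 | h1
  · exact hS.1 x hx g hg h1
  · by_cases e : x = g
    · subst e; exact sides_not_cross_left hc hs hcr
    · exact h.2.1 x (Or.inl ⟨hx, e⟩) g' (Or.inr rfl) h1

lemma mutExchange_of {S : Set Arc} (hS : IsTriangulation S) {g g' : Arc} (hg : g ∈ S)
    (hc : Cross g g') (hs : Sides g g' ⊆ S) : MutExchange S g g' := by
  have h0 : ∀ x ∈ S \ {g}, ¬ Cross x g' := by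
    rintro x ⟨hx, hxg⟩ hcr
    apply hxg
    refine eq_of_cross hc.symm hcr ?_
    intro s hs'
    rw [sides_symm] at hs'
    exact hS.1 x hx s (hs hs')
  refine ⟨?_, ?_, ?_⟩
  · rintro rfl; exact not_cross_self _ hc
  · rintro x (hx | hx) y (hy | hy)
    · exact hS.1 x hx.1 y hy.1
    · rw [Set.mem_singleton_iff.mp hy]; exact h0 x hx
    · rw [Set.mem_singleton_iff.mp hx]; exact fun h => h0 y hy h.symm
    · rw [Set.mem_singleton_iff.mp hx, Set.mem_singleton_iff.mp hy]; exact not_cross_self _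
  · intro d hd
    have hsd : ∀ s ∈ Sides g g', ¬ Cross d s := fun s h => hd s (Or.inl ⟨hs h, h.2.2.1⟩)
    by_cases hdg : Cross d g
    · right; exact eq_of_cross hc hdg hsd
    · left
      refine ⟨hS.2 d ?_, ?_⟩
      · intro x hx
        by_cases e : x = g
        · rw [e]; exact hdg
        · exact hd x (Or.inl ⟨hx, e⟩)
      · intro e
        rw [Set.mem_singleton_iff.mp e] at hd
        exact hd g' (Or.inr rfl) hc

lemma MutExchange.unique {S : Set Arc} (hS : IsTriangulation S) {g g' g'' : Arc} (hg : g ∈ S)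
    (h : MutExchange S g g') (h' : MutExchange S g g'') : g'' = g' := by
  refine eq_of_cross (h.cross hS hg) (h'.cross hS hg).symm ?_
  intro s hs
  exact h'.2.1 g'' (Or.inr rfl) s (Or.inl ⟨h.sides hS hg hs, hs.2.2.1⟩)

lemma IsMutable.exch {S : Set Arc} {g : Arc} (h : IsMutable S g) :
    MutExchange S g (flipArc S g) := by
  unfold flipArc
  rw [dif_pos h.2]
  exact h.2.choose_spec

lemma MutExchange.flip_eq {S : Set Arc} (hS : IsTriangulation S) {g g' : Arc} (hg : g ∈ S)
    (h : MutExchange S g g') : flipArc S g = g' :=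
  MutExchange.unique hS hg h (IsMutable.exch ⟨hg, g', h⟩)

lemma IsMutable.tri {S : Set Arc} {g : Arc} (h : IsMutable S g) : IsTriangulation (mutate S g) :=
  h.exch.2

lemma mutArc_image {S : Set Arc} {g : Arc} (hg : g ∈ S) : mutArc S g '' S = mutate S g := by
  ext x
  simp only [Set.mem_image, mutate, Set.mem_union, Set.mem_sdiff, Set.mem_singleton_iff, mutArc]
  constructor
  · rintro ⟨y, hy, rfl⟩
    split_ifs with e
    · right; rfl
    · left; exact ⟨hy, e⟩
  · rintro (⟨h1, h2⟩ | rfl)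
    · exact ⟨x, h1, by simp [h2]⟩
    · exact ⟨g, hg, by simp⟩

/-- Adjacency of mutable arcs is symmetric. -/
lemma mem_sides_symm {S : Set Arc} (hS : IsTriangulation S) {a a' s b : Arc}
    (ha : a ∈ S) (h : MutExchange S a a') (hs : s ∈ Sides a a') (h' : MutExchange S s b) :
    a ∈ Sides s b := by
  by_contra hn
  have hsS : s ∈ S := h.sides hS ha hs
  have hc := h'.cross hS hsS
  have hsub := h'.sides hS hsS
  rcases cross_side (h.cross hS ha) hs hc.symm with h1 | h1
  · refine hs.2.2.1 (eq_of_cross hc.symm h1.symm ?_).symm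
    intro x hx
    rw [sides_symm] at hx
    exact hS.1 a ha x (hsub hx)
  · refine hs.2.2.2 (eq_of_cross hc.symm h1.symm ?_).symm
    intro x hx
    rw [sides_symm] at hx
    refine h.2.1 a' (Or.inr rfl) x (Or.inl ⟨hsub hx, ?_⟩)
    rintro rfl
    exact hn hx

/-! ### Sequences of mutations -/

/-- Every entry of the sequence is mutable at its time. -/
def AllMut (T : Set Arc) (θ : ℕ → Option Arc) : Prop :=
  ∀ i γ, θ i = some γ → IsMutable (iterT T θ i) γ

lemma iterT_succ_none {T : Set Arc} {θ : ℕ → Option Arc} {n : ℕ} (h : θ n = none) :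
    iterT T θ (n + 1) = iterT T θ n := by simp [iterT, h, stepT]

lemma iterT_succ_some {T : Set Arc} {θ : ℕ → Option Arc} {n : ℕ} {a : Arc} (h : θ n = some a) :
    iterT T θ (n + 1) = mutate (iterT T θ n) a := by simp [iterT, h, stepT]

lemma iterA_succ_none {T : Set Arc} {θ : ℕ → Option Arc} {n : ℕ} (h : θ n = none) (d : Arc) :
    iterA T θ d (n + 1) = iterA T θ d n := by simp [iterA, h, stepA]

lemma iterA_succ_some {T : Set Arc} {θ : ℕ → Option Arc} {n : ℕ} {a : Arc} (h : θ n = some a)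
    (d : Arc) : iterA T θ d (n + 1) = mutArc (iterT T θ n) a (iterA T θ d n) := by
  simp [iterA, h, stepA]

lemma iterT_tri {T : Set Arc} (hT : IsTriangulation T) {θ : ℕ → Option Arc} (hm : AllMut T θ)
    (n : ℕ) : IsTriangulation (iterT T θ n) := by
  induction n with
  | zero => exact hT
  | succ n ih =>
    cases h : θ n with
    | none => rw [iterT_succ_none h]; exact ih
    | some a => rw [iterT_succ_some h]; exact (hm n a h).tri

lemma iterA_image {T : Set Arc} {θ : ℕ → Option Arc} (hm : AllMut T θ)
    (n : ℕ) : (fun d => iterA T θ d n) '' T = iterT T θ n := by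
  induction n with
  | zero => simp [iterA, iterT]
  | succ n ih =>
    cases h : θ n with
    | none =>
      rw [iterT_succ_none h, ← ih]
      simp only [iterA_succ_none h]
    | some a =>
      rw [iterT_succ_some h, ← mutArc_image (hm n a h).1]
      simp only [iterA_succ_some h]
      nth_rw 3 [← ih]
      rw [Set.image_image]

lemma iterA_mem {T : Set Arc} {θ : ℕ → Option Arc} (hm : AllMut T θ)
    (n : ℕ) {d : Arc} (hd : d ∈ T) : iterA T θ d n ∈ iterT T θ n := by
  rw [← iterA_image hm]; exact ⟨d, hd, rfl⟩

lemma mutArc_inj {S : Set Arc} (hS : IsTriangulation S) {a : Arc} (h : IsMutable S a) :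
    Set.InjOn (mutArc S a) S := by
  have hn := h.exch.not_mem hS h.1
  intro x hx y hy e
  unfold mutArc at e
  split_ifs at e with h1 h2 h2
  · rw [h1, h2]
  · exact absurd (e ▸ hy) hn
  · exact absurd (e ▸ hx) hn
  · exact e

lemma iterA_inj {T : Set Arc} (hT : IsTriangulation T) {θ : ℕ → Option Arc} (hm : AllMut T θ)
    (n : ℕ) : Set.InjOn (fun d => iterA T θ d n) T := by
  induction n with
  | zero => intro x _ y _ e; exact e
  | succ n ih =>
    cases h : θ n with
    | none => simp only [iterA_succ_none h]; exact ih
    | some a =>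
      simp only [iterA_succ_some h]
      intro x hx y hy e
      exact ih hx hy (mutArc_inj (iterT_tri hT hm n) (hm n a h) (iterA_mem hm n hx)
        (iterA_mem hm n hy) e)

lemma seqLimit_eq {T : Set Arc} {θ : ℕ → Option Arc} {d : Arc} {l : ℕ} {v : Arc}
    (h : ∀ k, l ≤ k → iterA T θ d k = v) : seqLimit T θ d = v := by
  have hex : ∃ l, ∀ k, l ≤ k → iterA T θ d k = iterA T θ d l :=
    ⟨l, fun k hk => by rw [h k hk, h l le_rfl]⟩
  unfold seqLimit
  rw [dif_pos hex]
  have h1 := hex.choose_spec (max l hex.choose) (le_max_right _ _)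
  rw [← h1]
  exact h _ (le_max_left _ _)

lemma seqLimit_spec {T : Set Arc} {θ : ℕ → Option Arc} {d : Arc}
    (h : ∃ l, ∀ k, l ≤ k → iterA T θ d k = iterA T θ d l) :
    ∃ l, ∀ k, l ≤ k → iterA T θ d k = seqLimit T θ d := by
  obtain ⟨l, hl⟩ := h
  exact ⟨l, fun k hk => by rw [seqLimit_eq hl]; exact hl k hk⟩

/-! ### Removing gaps -/

/-- The sequence with the empty entries removed. -/
noncomputable def compress (θ : ℕ → Option Arc) (j : ℕ) : Option Arc :=
  if h : ∃ i, θ i ≠ none ∧ Nat.count (fun i => θ i ≠ none) i = j then θ h.choose else none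

lemma compress_count {θ : ℕ → Option Arc} {i : ℕ} (hi : θ i ≠ none) :
    compress θ (Nat.count (fun i => θ i ≠ none) i) = θ i := by
  have hex : ∃ i', θ i' ≠ none ∧ Nat.count (fun i => θ i ≠ none) i' =
    Nat.count (fun i => θ i ≠ none) i := ⟨i, hi, rfl⟩
  unfold compress
  rw [dif_pos hex]
  obtain ⟨h1, h2⟩ := hex.choose_spec
  rw [Nat.count_injective h1 hi h2]

lemma compress_some {θ : ℕ → Option Arc} {j : ℕ} {a : Arc} (h : compress θ j = some a) :
    ∃ i, θ i = some a ∧ Nat.count (fun i => θ i ≠ none) i = j := by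
  unfold compress at h
  split_ifs at h with hex
  exact ⟨hex.choose, h, hex.choose_spec.2⟩

lemma iterT_compress (T : Set Arc) (θ : ℕ → Option Arc) (i : ℕ) :
    iterT T (compress θ) (Nat.count (fun i => θ i ≠ none) i) = iterT T θ i := by
  induction i with
  | zero => simp [iterT]
  | succ i ih =>
    cases h : θ i with
    | none =>
      rw [iterT_succ_none h, Nat.count_succ, if_neg (by simp [h]), add_zero, ih]
    | some a =>
      have hi : θ i ≠ none := by simp [h]
      rw [iterT_succ_some h, Nat.count_succ, if_pos hi,
        iterT_succ_some ((compress_count hi).trans h), ih]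

lemma iterA_compress (T : Set Arc) (θ : ℕ → Option Arc) (d : Arc) (i : ℕ) :
    iterA T (compress θ) d (Nat.count (fun i => θ i ≠ none) i) = iterA T θ d i := by
  induction i with
  | zero => simp [iterA]
  | succ i ih =>
    cases h : θ i with
    | none =>
      rw [iterA_succ_none h, Nat.count_succ, if_neg (by simp [h]), add_zero, ih]
    | some a =>
      have hi : θ i ≠ none := by simp [h]
      rw [iterA_succ_some h, Nat.count_succ, if_pos hi,
        iterA_succ_some ((compress_count hi).trans h), ih, iterT_compress]

lemma count_downward {p : ℕ → Prop} [DecidablePred p] {j : ℕ} (i : ℕ)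
    (hc : j < Nat.count p i) : ∃ i', p i' ∧ Nat.count p i' = j := by
  induction i with
  | zero => simp at hc
  | succ i ih =>
    by_cases h : j < Nat.count p i
    · exact ih h
    · rw [Nat.count_succ] at hc
      split_ifs at hc with hp
      · exact ⟨i, hp, by omega⟩
      · omega

lemma compress_admissible {T : Set Arc} {θ : ℕ → Option Arc} (hm : AllMut T θ)
    {f : Arc → Arc} (hs : ∀ d ∈ T, ∃ l, ∀ k, l ≤ k → iterA T θ d k = f d) :
    Admissible T (compress θ) ∧ mutSeq T (compress θ) = f '' T := by
  have key : ∀ d ∈ T, ∃ l, ∀ k, l ≤ k → iterA T (compress θ) d k = f d := by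
    intro d hd
    obtain ⟨l, hl⟩ := hs d hd
    refine ⟨Nat.count (fun i => θ i ≠ none) l, ?_⟩
    intro k hk
    induction k, hk using Nat.le_induction with
    | base => rw [iterA_compress]; exact hl l le_rfl
    | succ m hlm ih =>
      cases h : compress θ m with
      | none => rw [iterA_succ_none h]; exact ih
      | some a =>
        obtain ⟨i, hi, rfl⟩ := compress_some h
        have hi' : θ i ≠ none := by simp [hi]
        have e : Nat.count (fun i => θ i ≠ none) i + 1 =
            Nat.count (fun i => θ i ≠ none) (i + 1) := by
          rw [Nat.count_succ, if_pos hi']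
        rw [e, iterA_compress]
        apply hl
        by_contra hlt
        have := Nat.count_monotone (fun i => θ i ≠ none) (show i + 1 ≤ l by omega)
        omega
  refine ⟨⟨?_, ?_, ?_⟩, ?_⟩
  · intro j hj
    by_contra hn
    obtain ⟨a, ha⟩ := Option.ne_none_iff_exists'.mp hn
    obtain ⟨i, hi, hc⟩ := compress_some ha
    obtain ⟨i', h1, h2⟩ := count_downward (p := fun i => θ i ≠ none) (j := j) i (by omega)
    have := compress_count h1
    rw [h2, hj] at this
    exact h1 this.symm
  · intro j a ha
    obtain ⟨i, hi, rfl⟩ := compress_some ha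
    rw [iterT_compress]
    exact hm i a hi
  · intro d hd
    obtain ⟨l, hl⟩ := key d hd
    exact ⟨l, fun k hk => by rw [hl k hk, hl l le_rfl]⟩
  · unfold mutSeq
    apply Set.image_congr
    intro d hd
    obtain ⟨l, hl⟩ := key d hd
    exact seqLimit_eq hl

/-! ### The grid -/

/-- Arcs of `T'` involved in the first `k` mutations along `β`. -/
def InvArcs (T' : Set Arc) (β : ℕ → Option Arc) (k : ℕ) : Set Arc :=
  {t | t ∈ T' ∧ ∃ j < k, ∃ b, β j = some b ∧
    (iterA T' β t j = b ∨ iterA T' β t j ∈ Sides b (flipArc (iterT T' β j) b))}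

/-- All involved arcs are present from time `n` on. -/
def Ready (T : Set Arc) (α : ℕ → Option Arc) (T' : Set Arc) (β : ℕ → Option Arc)
    (n k : ℕ) : Prop :=
  ∀ t ∈ InvArcs T' β k, ∀ m, n ≤ m → t ∈ iterT T α m

lemma InvArcs_mono {T' : Set Arc} {β : ℕ → Option Arc} {j k : ℕ} (h : j ≤ k) :
    InvArcs T' β j ⊆ InvArcs T' β k := by
  rintro t ⟨ht, i, hi, r⟩
  exact ⟨ht, i, by omega, r⟩

lemma Ready.mono {T T' : Set Arc} {α β : ℕ → Option Arc} {n n' k k' : ℕ}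
    (h : Ready T α T' β n k) (hn : n ≤ n') (hk : k' ≤ k) : Ready T α T' β n' k' :=
  fun t ht m hm => h t (InvArcs_mono hk ht) m (hn.trans hm)

lemma ready_zero {T T' : Set Arc} {α β : ℕ → Option Arc} {n : ℕ} : Ready T α T' β n 0 := by
  rintro t ⟨_, i, hi, _⟩; omega

lemma InvArcs_finite {T' : Set Arc} (hT' : IsTriangulation T') {β : ℕ → Option Arc}
    (hβ : AllMut T' β) (k : ℕ) : (InvArcs T' β k).Finite := by
  have : InvArcs T' β k ⊆ ⋃ j ∈ Finset.range k, {t | t ∈ T' ∧ ∃ b, β j = some b ∧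
    (iterA T' β t j = b ∨ iterA T' β t j ∈ Sides b (flipArc (iterT T' β j) b))} := by
    rintro t ⟨ht, j, hj, r⟩
    simp only [Set.mem_iUnion]
    exact ⟨j, Finset.mem_range.mpr hj, ht, r⟩
  refine Set.Finite.subset ?_ this
  refine Set.Finite.biUnion (Finset.finite_toSet _) ?_
  intro j _
  cases h : β j with
  | none =>
    convert Set.finite_empty
    ext t; simp
  | some b =>
    have hf : (({b} : Set Arc) ∪ Sides b (flipArc (iterT T' β j) b)).Finite :=
      (Set.finite_singleton b).union (sides_finite _ _)
    refine Set.Finite.of_finite_image (f := fun d => iterA T' β d j) (hf.subset ?_) ?_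
    · rintro _ ⟨t, ⟨_, b', hb', r⟩, rfl⟩
      obtain rfl : b = b' := Option.some.inj hb'
      exact r
    · exact (iterA_inj hT' hβ j).mono (fun t ht => ht.1)

lemma exists_ready {T T' : Set Arc} {α β : ℕ → Option Arc}
    (hα : AllMut T α) (hT' : IsTriangulation T') (hβ : AllMut T' β)
    (hlim : ∀ t ∈ T', ∃ d ∈ T, ∃ l, ∀ k, l ≤ k → iterA T α d k = t) (k : ℕ) :
    ∃ n, Ready T α T' β n k := by
  have h1 : ∀ t ∈ InvArcs T' β k, ∃ n, ∀ m, n ≤ m → t ∈ iterT T α m := by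
    intro t ht
    obtain ⟨d, hd, l, hl⟩ := hlim t ht.1
    exact ⟨l, fun m hm => hl m hm ▸ iterA_mem hα m hd⟩
  choose! N hN using h1
  obtain ⟨M, hM⟩ := ((InvArcs_finite hT' hβ k).image N).bddAbove
  exact ⟨M, fun t ht m hm => hN t ht m ((hM ⟨t, ht, rfl⟩).trans hm)⟩

/-- Arcs of `T'` that are not involved are not moved. -/
lemma fix_of_mem {T' : Set Arc} {β : ℕ → Option Arc} {k : ℕ} {t : Arc} (ht : t ∈ T')
    (hn : t ∉ InvArcs T' β k) : iterA T' β t k = t := by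
  induction k with
  | zero => rfl
  | succ k ih =>
    have ih' := ih (fun h => hn (InvArcs_mono (Nat.le_succ k) h))
    cases h : β k with
    | none => rw [iterA_succ_none h, ih']
    | some b =>
      rw [iterA_succ_some h, ih']
      have : t ≠ b := by
        rintro rfl
        exact hn ⟨ht, k, Nat.lt_succ_self k, t, h, Or.inl ih'⟩
      simp [mutArc, this]

section
variable {T T' : Set Arc} {α β : ℕ → Option Arc}

lemma mem_of_both (hT : IsTriangulation T) (hα : AllMut T α)
    (hT' : IsTriangulation T') (hβ : AllMut T' β) {n k : ℕ} (hr : Ready T α T' β n k)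
    {t : Arc} (h1 : t ∈ iterT T α n) (h2 : t ∈ iterT T' β k) : t ∈ T' := by
  apply hT'.2
  intro x hx hc
  by_cases hi : x ∈ InvArcs T' β k
  · exact (iterT_tri hT hα n).1 t h1 x (hr x hi n le_rfl) hc
  · have := iterA_mem hβ k hx
    rw [fix_of_mem hx hi] at this
    exact (iterT_tri hT' hβ k).1 t h2 x this hc

lemma fix_of_ready (hT : IsTriangulation T) (hα : AllMut T α)
    (hT' : IsTriangulation T') (hβ : AllMut T' β) {n k : ℕ} (hr : Ready T α T' β n k)
    {t : Arc} (h1 : t ∈ iterT T α n) (hn : t ∉ InvArcs T' β k) : iterA T' β t k = t := by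
  induction k with
  | zero => rfl
  | succ k ih =>
    have hr' := hr.mono le_rfl (Nat.le_succ k)
    have ih' := ih hr' (fun h => hn (InvArcs_mono (Nat.le_succ k) h))
    cases h : β k with
    | none => rw [iterA_succ_none h, ih']
    | some b =>
      rw [iterA_succ_some h, ih']
      have : t ≠ b := by
        rintro rfl
        have := mem_of_both hT hα hT' hβ hr' h1 (hβ k t h).1
        exact hn ⟨this, k, Nat.lt_succ_self k, t, h, Or.inl ih'⟩
      simp [mutArc, this]

/-- The triangulation after `n` steps of `α` and `k` steps of `β`. -/
def grid (T : Set Arc) (α : ℕ → Option Arc) (T' : Set Arc) (β : ℕ → Option Arc)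
    (n k : ℕ) : Set Arc := (fun d => iterA T' β d k) '' iterT T α n

lemma grid_beta_exch (hT' : IsTriangulation T') (hβ : AllMut T' β) {n k : ℕ}
    (hr : Ready T α T' β n (k + 1)) (hS : IsTriangulation (grid T α T' β n k))
    {b : Arc} (hb : β k = some b) :
    b ∈ grid T α T' β n k ∧
      MutExchange (grid T α T' β n k) b (flipArc (iterT T' β k) b) := by
  have hm := hβ k b hb
  have htri := iterT_tri hT' hβ k
  have aux : ∀ q ∈ iterT T' β k, (q = b ∨ q ∈ Sides b (flipArc (iterT T' β k) b)) →
      q ∈ grid T α T' β n k := by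
    intro q hq hq'
    rw [← iterA_image hβ] at hq
    obtain ⟨t, ht, rfl⟩ := hq
    exact ⟨t, hr t ⟨ht, k, Nat.lt_succ_self k, b, hb, hq'⟩ n le_rfl, rfl⟩
  have hbS := aux b hm.1 (Or.inl rfl)
  exact ⟨hbS, mutExchange_of hS hbS (hm.exch.cross htri hm.1)
    (fun s hs => aux s (hm.exch.sides htri hm.1 hs) (Or.inr hs))⟩

lemma grid_beta_mut (hT' : IsTriangulation T') (hβ : AllMut T' β) {n k : ℕ}
    (hr : Ready T α T' β n (k + 1)) (hS : IsTriangulation (grid T α T' β n k))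
    {b : Arc} (hb : β k = some b) :
    IsMutable (grid T α T' β n k) b ∧
    mutArc (grid T α T' β n k) b = mutArc (iterT T' β k) b ∧
    grid T α T' β n (k + 1) = mutate (grid T α T' β n k) b := by
  obtain ⟨h1, h2⟩ := grid_beta_exch hT' hβ hr hS hb
  have e : mutArc (grid T α T' β n k) b = mutArc (iterT T' β k) b := by
    funext x
    simp only [mutArc, h2.flip_eq hS h1]
  refine ⟨⟨h1, _, h2⟩, e, ?_⟩
  rw [← mutArc_image h1, e]
  unfold grid
  simp only [iterA_succ_some hb]
  rw [Set.image_image]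

lemma grid_tri (hT : IsTriangulation T) (hα : AllMut T α)
    (hT' : IsTriangulation T') (hβ : AllMut T' β) {n k : ℕ} (hr : Ready T α T' β n k) :
    IsTriangulation (grid T α T' β n k) := by
  induction k with
  | zero => simpa [grid, iterA] using iterT_tri hT hα n
  | succ k ih =>
    have ih' := ih (hr.mono le_rfl (Nat.le_succ k))
    cases h : β k with
    | none =>
      have : grid T α T' β n (k + 1) = grid T α T' β n k := by
        unfold grid; simp only [iterA_succ_none h]
      rw [this]; exact ih'
    | some b =>
      obtain ⟨h1, -, h3⟩ := grid_beta_mut hT' hβ hr ih' h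
      rw [h3]; exact h1.tri

lemma not_inv_of_mut (hT : IsTriangulation T) (hα : AllMut T α) {n k : ℕ}
    (hr : Ready T α T' β n k) {a : Arc} (ha : α n = some a) : a ∉ InvArcs T' β k := by
  intro h
  have h1 := hr a h (n + 1) (Nat.le_succ n)
  rw [iterT_succ_some ha] at h1
  rcases h1 with h1 | h1
  · exact h1.2 rfl
  · exact (hα n a ha).exch.1 (Set.mem_singleton_iff.mp h1).symm

lemma sides_fix (hT : IsTriangulation T) (hα : AllMut T α)
    (hT' : IsTriangulation T') (hβ : AllMut T' β) {n k : ℕ} (hr : Ready T α T' β n k)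
    {a : Arc} (ha : α n = some a) {s : Arc} (hs : s ∈ Sides a (flipArc (iterT T α n) a)) :
    iterA T' β s k = s := by
  have hm := hα n a ha
  have htri := iterT_tri hT hα n
  induction k generalizing s with
  | zero => rfl
  | succ k ih =>
    have hr' := hr.mono le_rfl (Nat.le_succ k)
    have haI := not_inv_of_mut hT hα hr ha
    have hak : iterA T' β a k = a :=
      fix_of_ready hT hα hT' hβ hr' hm.1 (not_inv_of_mut hT hα hr' ha)
    cases h : β k with
    | none => rw [iterA_succ_none h, ih hr' hs]
    | some b =>
      rw [iterA_succ_some h, ih hr' hs]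
      have : s ≠ b := by
        rintro rfl
        have hS := grid_tri hT hα hT' hβ hr'
        have haS : a ∈ grid T α T' β n k := ⟨a, hm.1, hak⟩
        have hex : MutExchange (grid T α T' β n k) a (flipArc (iterT T α n) a) := by
          refine mutExchange_of hS haS (hm.exch.cross htri hm.1) ?_
          intro x hx
          exact ⟨x, hm.exch.sides htri hm.1 hx, ih hr' hx⟩
        obtain ⟨_, hsx⟩ := grid_beta_exch hT' hβ hr hS h
        have hmem := mem_sides_symm hS haS hex hs hsx
        have hak' : a ∈ iterT T' β k :=
          (hβ k s h).exch.sides (iterT_tri hT' hβ k) (hβ k s h).1 hmem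
        have haT' := mem_of_both hT hα hT' hβ hr' hm.1 hak'
        exact haI ⟨haT', k, Nat.lt_succ_self k, s, h, Or.inr (by rw [hak]; exact hmem)⟩
      simp [mutArc, this]

lemma grid_alpha_mut (hT : IsTriangulation T) (hα : AllMut T α)
    (hT' : IsTriangulation T') (hβ : AllMut T' β) {n k : ℕ} (hr : Ready T α T' β n k)
    {a : Arc} (ha : α n = some a) :
    IsMutable (grid T α T' β n k) a ∧
    (∀ x ∈ iterT T α n, mutArc (grid T α T' β n k) a (iterA T' β x k) =
      iterA T' β (mutArc (iterT T α n) a x) k) ∧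
    grid T α T' β (n + 1) k = mutate (grid T α T' β n k) a := by
  have hm := hα n a ha
  have htri := iterT_tri hT hα n
  have hS := grid_tri hT hα hT' hβ hr
  have haI := not_inv_of_mut hT hα hr ha
  have hak : iterA T' β a k = a := fix_of_ready hT hα hT' hβ hr hm.1 haI
  have haS : a ∈ grid T α T' β n k := ⟨a, hm.1, hak⟩
  have hex : MutExchange (grid T α T' β n k) a (flipArc (iterT T α n) a) := by
    refine mutExchange_of hS haS (hm.exch.cross htri hm.1) ?_
    intro x hx
    exact ⟨x, hm.exch.sides htri hm.1 hx, sides_fix hT hα hT' hβ hr ha hx⟩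
  have hfl := hex.flip_eq hS haS
  have hcomm : ∀ x ∈ iterT T α n, mutArc (grid T α T' β n k) a (iterA T' β x k) =
      iterA T' β (mutArc (iterT T α n) a x) k := by
    intro x hx
    by_cases e : x = a
    · subst e
      have hf : iterA T' β (flipArc (iterT T α n) x) k = flipArc (iterT T α n) x := by
        refine fix_of_ready hT hα hT' hβ (hr.mono (Nat.le_succ n) le_rfl) ?_ ?_
        · rw [iterT_succ_some ha]; exact Or.inr rfl
        · intro h
          exact hm.exch.not_mem htri hm.1 (hr _ h n le_rfl)
      simp [mutArc, hak, hfl, hf]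
    · have hne : iterA T' β x k ≠ a := by
        intro h
        by_cases hxI : x ∈ InvArcs T' β k
        · have hak' : a ∈ iterT T' β k := h ▸ iterA_mem hβ k hxI.1
          have haT' := mem_of_both hT hα hT' hβ hr hm.1 hak'
          exact e (iterA_inj hT' hβ k hxI.1 haT' (h.trans hak.symm))
        · exact e ((fix_of_ready hT hα hT' hβ hr hx hxI).symm.trans h)
      simp [mutArc, e, hne]
  refine ⟨⟨haS, _, hex⟩, hcomm, ?_⟩
  rw [← mutArc_image haS]
  have e1 : grid T α T' β (n + 1) k =
      (fun d => iterA T' β d k) '' (mutArc (iterT T α n) a '' iterT T α n) := by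
    unfold grid; rw [iterT_succ_some ha, mutArc_image hm.1]
  rw [e1, Set.image_image]
  conv_rhs => rw [grid.eq_def T α T' β n k]
  rw [Set.image_image]
  apply Set.image_congr
  intro x hx
  exact (hcomm x hx).symm

/-! ### The interleaved sequence -/

/-- Number of steps of `β` done after `i` rounds. -/
noncomputable def prog (T : Set Arc) (α : ℕ → Option Arc) (T' : Set Arc) (β : ℕ → Option Arc) :
    ℕ → ℕ
  | 0 => 0
  | i + 1 => if Ready T α T' β (i + 1) (prog T α T' β i + 1) then prog T α T' β i + 1
      else prog T α T' β i

/-- The interleaved sequence. -/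
noncomputable def inter (T : Set Arc) (α : ℕ → Option Arc) (T' : Set Arc) (β : ℕ → Option Arc)
    (m : ℕ) : Option Arc :=
  if m % 2 = 0 then α (m / 2) else
    if Ready T α T' β (m / 2 + 1) (prog T α T' β (m / 2) + 1) then β (prog T α T' β (m / 2))
    else none

lemma inter_even (i : ℕ) : inter T α T' β (2 * i) = α i := by
  have h1 : (2 * i) % 2 = 0 := by omega
  have h2 : (2 * i) / 2 = i := by omega
  simp only [inter, h1, h2, if_true]

lemma inter_odd (i : ℕ) : inter T α T' β (2 * i + 1) =
    if Ready T α T' β (i + 1) (prog T α T' β i + 1) then β (prog T α T' β i) else none := by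
  have h1 : ¬ (2 * i + 1) % 2 = 0 := by omega
  have h2 : (2 * i + 1) / 2 = i := by omega
  simp only [inter, if_neg h1, h2]

lemma ready_prog (i : ℕ) : Ready T α T' β i (prog T α T' β i) := by
  induction i with
  | zero => exact ready_zero
  | succ i ih =>
    rw [prog]
    split_ifs with h
    · exact h
    · exact ih.mono (Nat.le_succ i) le_rfl

lemma prog_mono : Monotone (prog T α T' β) := by
  apply monotone_nat_of_le_succ
  intro i
  rw [prog]
  split_ifs <;> omega

lemma prog_unbounded (hrd : ∀ k, ∃ n, Ready T α T' β n k) (K : ℕ) :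
    ∃ i, K ≤ prog T α T' β i := by
  induction K with
  | zero => exact ⟨0, Nat.zero_le _⟩
  | succ K ih =>
    obtain ⟨i, hi⟩ := ih
    obtain ⟨n, hn⟩ := hrd (K + 1)
    refine ⟨max i n + 1, ?_⟩
    have h1 : K ≤ prog T α T' β (max i n) := hi.trans (prog_mono (le_max_left _ _))
    by_cases h2 : K + 1 ≤ prog T α T' β (max i n)
    · exact h2.trans (prog_mono (Nat.le_succ _))
    · have h3 : prog T α T' β (max i n) = K := by omega
      rw [prog, h3, if_pos (hn.mono (by omega) le_rfl)]

lemma step_alpha (hT : IsTriangulation T) (hα : AllMut T α)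
    (hT' : IsTriangulation T') (hβ : AllMut T' β) {i : ℕ}
    (h : iterT T (inter T α T' β) (2 * i) = grid T α T' β i (prog T α T' β i) ∧
      ∀ d ∈ T, iterA T (inter T α T' β) d (2 * i) =
        iterA T' β (iterA T α d i) (prog T α T' β i)) :
    iterT T (inter T α T' β) (2 * i + 1) = grid T α T' β (i + 1) (prog T α T' β i) ∧
      ∀ d ∈ T, iterA T (inter T α T' β) d (2 * i + 1) =
        iterA T' β (iterA T α d (i + 1)) (prog T α T' β i) := by
  obtain ⟨h1, h2⟩ := h
  have hr := ready_prog (T := T) (α := α) (T' := T') (β := β) i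
  cases ha : α i with
  | none =>
    have ha' : inter T α T' β (2 * i) = none := by rw [inter_even, ha]
    refine ⟨?_, fun d hd => ?_⟩
    · rw [iterT_succ_none ha', h1]
      unfold grid; rw [iterT_succ_none ha]
    · rw [iterA_succ_none ha', iterA_succ_none ha, h2 d hd]
  | some a =>
    have ha' : inter T α T' β (2 * i) = some a := by rw [inter_even, ha]
    obtain ⟨-, g2, g3⟩ := grid_alpha_mut hT hα hT' hβ hr ha
    refine ⟨?_, fun d hd => ?_⟩
    · rw [iterT_succ_some ha', h1, g3]
    · rw [iterA_succ_some ha', iterA_succ_some ha, h2 d hd, h1, g2 _ (iterA_mem hα i hd)]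

lemma inter_spec (hT : IsTriangulation T) (hα : AllMut T α)
    (hT' : IsTriangulation T') (hβ : AllMut T' β) (i : ℕ) :
    iterT T (inter T α T' β) (2 * i) = grid T α T' β i (prog T α T' β i) ∧
      ∀ d ∈ T, iterA T (inter T α T' β) d (2 * i) =
        iterA T' β (iterA T α d i) (prog T α T' β i) := by
  induction i with
  | zero => simp [iterT, iterA, grid, prog]
  | succ i ih =>
    obtain ⟨h1, h2⟩ := step_alpha hT hα hT' hβ ih
    have e2 : 2 * (i + 1) = 2 * i + 1 + 1 := by ring
    rw [e2]
    by_cases hrd : Ready T α T' β (i + 1) (prog T α T' β i + 1)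
    · have hp : prog T α T' β (i + 1) = prog T α T' β i + 1 := by rw [prog, if_pos hrd]
      have hS := grid_tri hT hα hT' hβ (hrd.mono le_rfl (Nat.le_succ _))
      rw [hp]
      cases hb : β (prog T α T' β i) with
      | none =>
        have hb' : inter T α T' β (2 * i + 1) = none := by rw [inter_odd, if_pos hrd, hb]
        refine ⟨?_, fun d hd => ?_⟩
        · rw [iterT_succ_none hb', h1]
          unfold grid; simp only [iterA_succ_none hb]
        · rw [iterA_succ_none hb', iterA_succ_none hb, h2 d hd]
      | some b =>
        have hb' : inter T α T' β (2 * i + 1) = some b := by rw [inter_odd, if_pos hrd, hb]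
        obtain ⟨-, g2, g3⟩ := grid_beta_mut hT' hβ hrd hS hb
        refine ⟨?_, fun d hd => ?_⟩
        · rw [iterT_succ_some hb', h1, g3]
        · rw [iterA_succ_some hb', iterA_succ_some hb, h2 d hd, h1, g2]
    · have hp : prog T α T' β (i + 1) = prog T α T' β i := by rw [prog, if_neg hrd]
      have hb' : inter T α T' β (2 * i + 1) = none := by rw [inter_odd, if_neg hrd]
      rw [hp]
      exact ⟨by rw [iterT_succ_none hb', h1], fun d hd => by rw [iterA_succ_none hb', h2 d hd]⟩

lemma inter_allMut (hT : IsTriangulation T) (hα : AllMut T α)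
    (hT' : IsTriangulation T') (hβ : AllMut T' β) : AllMut T (inter T α T' β) := by
  intro m c hc
  have hsp := inter_spec hT hα hT' hβ (m / 2)
  have hr := ready_prog (T := T) (α := α) (T' := T') (β := β) (m / 2)
  obtain h | h : m = 2 * (m / 2) ∨ m = 2 * (m / 2) + 1 := by omega
  · generalize m / 2 = i at *
    subst h
    rw [inter_even] at hc
    rw [hsp.1]
    exact (grid_alpha_mut hT hα hT' hβ hr hc).1
  · generalize m / 2 = i at *
    subst h
    rw [inter_odd] at hc
    split_ifs at hc with hrd
    rw [(step_alpha hT hα hT' hβ hsp).1]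
    exact (grid_beta_mut hT' hβ hrd
      (grid_tri hT hα hT' hβ (hrd.mono le_rfl (Nat.le_succ _))) hc).1

end

/-- Transitivity of mutation along admissible sequences: if `μ_α(T) = T'` and
`μ_β(T') = T''`, then there is a `T`-admissible sequence `γ` with `μ_γ(T) = T''`. -/
theorem statement10 (T T' T'' : Set Arc)
    (hT : IsTriangulation T) (hT' : IsTriangulation T') (hT'' : IsTriangulation T'')
    (α : ℕ → Option Arc) (hα : Admissible T α) (hαT : mutSeq T α = T')
    (β : ℕ → Option Arc) (hβ : Admissible T' β) (hβT : mutSeq T' β = T'') :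
    ∃ γ : ℕ → Option Arc, Admissible T γ ∧ mutSeq T γ = T'' := by
  have mα : AllMut T α := hα.2.1
  have mβ : AllMut T' β := hβ.2.1
  have hlim : ∀ t ∈ T', ∃ d ∈ T, ∃ l, ∀ k, l ≤ k → iterA T α d k = t := by
    intro t ht
    rw [← hαT] at ht
    obtain ⟨d, hd, rfl⟩ := ht
    exact ⟨d, hd, seqLimit_spec (hα.2.2 d hd)⟩
  have hrd := exists_ready mα hT' mβ hlim
  have hs : ∀ d ∈ T, ∃ l, ∀ k, l ≤ k → iterA T (inter T α T' β) d k =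
      seqLimit T' β (seqLimit T α d) := by
    intro d hd
    obtain ⟨l, hl⟩ := seqLimit_spec (hα.2.2 d hd)
    have hd' : seqLimit T α d ∈ T' := by rw [← hαT]; exact ⟨d, hd, rfl⟩
    obtain ⟨l', hl'⟩ := seqLimit_spec (hβ.2.2 _ hd')
    obtain ⟨i0, hi0⟩ := prog_unbounded hrd l'
    refine ⟨2 * max l i0, fun k hk => ?_⟩
    have hsp := inter_spec hT mα hT' mβ (k / 2)
    have hk1 : l ≤ k / 2 := by have := le_max_left l i0; omega
    have hk2 : i0 ≤ k / 2 := by have := le_max_right l i0; omega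
    have hp := hi0.trans (prog_mono (T := T) (α := α) (T' := T') (β := β) hk2)
    obtain h | h : k = 2 * (k / 2) ∨ k = 2 * (k / 2) + 1 := by omega
    · rw [h, hsp.2 d hd, hl _ hk1, hl' _ hp]
    · rw [h, (step_alpha hT mα hT' mβ hsp).2 d hd, hl _ (by omega), hl' _ hp]
  obtain ⟨h1, h2⟩ := compress_admissible (inter_allMut hT mα hT' mβ) hs
  refine ⟨_, h1, ?_⟩
  rw [h2, ← hβT, ← hαT]
  unfold mutSeq
  rw [Set.image_image]
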